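/- Let (Ω, μ) be a measure space, β ≥ 0, λ₀ > 0, v₀ ∈ ℝ, l₁ ≥ 0. Let A : Ω → M₂(ℝ) and v, l, h : Ω → ℝ be measurable with h ≥ 0, v(x) ≥ v₀ and |l(x)| ≤ l₁ for all x ∈ Ω, such that the functions x ↦ ‖A(x)‖_F², x ↦ b_β(S(A(x)), S(A(x))), x ↦ b_β(S(A(x)), G(v(x), l(x), A(x))) and h are integrable, and such that the Korn-type bound ∫_Ω ‖A(x)‖_F² dμ ≤ λ₀·∫_Ω ( b_β(S(A(x)), S(A(x))) + h(x) ) dμ holds. Then ∫_Ω b_β(S(A(x)), G(v(x), l(x), A(x))) dμ ≥ ( v₀ − λ₀·(1+2β)·l₁/2 )·∫_Ω b_β(S(A(x)), S(A(x))) dμ − λ₀·(1+2β)·(l₁/2)·∫_Ω h dμ. -/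

import Mathlib

open Matrix MeasureTheory

/-- Frobenius inner product of 2×2 real matrices. -/
noncomputable def frobInner (T₁ T₂ : Matrix (Fin 2) (Fin 2) ℝ) : ℝ :=
  ∑ i, ∑ j, T₁ i j * T₂ i j

/-- The strain bilinear form `b_β(T₁,T₂) = ⟨T₁,T₂⟩_F + β (tr T₁)(tr T₂)`. -/
noncomputable def bform (β : ℝ) (T₁ T₂ : Matrix (Fin 2) (Fin 2) ℝ) : ℝ :=
  frobInner T₁ T₂ + β * (T₁.trace * T₂.trace)

/-- Symmetric part `S(A) = (A + Aᵀ)/2`. -/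
noncomputable def symPart (A : Matrix (Fin 2) (Fin 2) ℝ) : Matrix (Fin 2) (Fin 2) ℝ :=
  (1 / 2 : ℝ) • (A + Aᵀ)

/-- The rotation matrix `J = !![0, -1; 1, 0]`. -/
noncomputable def Jrot : Matrix (Fin 2) (Fin 2) ℝ := !![0, -1; 1, 0]

/-- `G(v, l, A) = S(A·(v·I + l·J))`. -/
noncomputable def Gmat (v l : ℝ) (A : Matrix (Fin 2) (Fin 2) ℝ) : Matrix (Fin 2) (Fin 2) ℝ :=
  (1 / 2 : ℝ) • (A * (v • (1 : Matrix (Fin 2) (Fin 2) ℝ) + l • Jrot)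
    + (A * (v • (1 : Matrix (Fin 2) (Fin 2) ℝ) + l • Jrot))ᵀ)

theorem bform_symPart_self_nonneg {β : ℝ} (hβ : 0 ≤ β) (A : Matrix (Fin 2) (Fin 2) ℝ) :
    0 ≤ bform β (symPart A) (symPart A) := by
  have h : 0 ≤ frobInner (symPart A) (symPart A) :=
    Finset.sum_nonneg fun _ _ => Finset.sum_nonneg fun _ _ => mul_self_nonneg _
  exact add_nonneg h (mul_nonneg hβ (mul_self_nonneg _))

theorem bform_symPart_Gmat (β v l : ℝ) (A : Matrix (Fin 2) (Fin 2) ℝ) :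
    bform β (symPart A) (Gmat v l A) = v * bform β (symPart A) (symPart A)
      + l * ((1 + 2 * β) / 2 * ((A 0 0 + A 1 1) * (A 0 1 - A 1 0))) := by
  simp [bform, frobInner, symPart, Gmat, Jrot, Matrix.mul_apply, Matrix.trace, Fin.sum_univ_two,
    Matrix.one_apply]
  ring

theorem abs_trace_mul_sub_le_frobInner (A : Matrix (Fin 2) (Fin 2) ℝ) :
    |(A 0 0 + A 1 1) * (A 0 1 - A 1 0)| ≤ frobInner A A := by
  simp only [frobInner, Fin.sum_univ_two]
  rw [abs_le]
  constructor <;>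
    nlinarith [sq_nonneg (A 0 0 + A 1 1 + (A 0 1 - A 1 0)), sq_nonneg (A 0 0 - A 1 1),
      sq_nonneg (A 0 0 + A 1 1 - (A 0 1 - A 1 0)), sq_nonneg (A 0 1 + A 1 0)]

theorem le_bform_symPart_Gmat {β v₀ l₁ v l : ℝ} (hβ : 0 ≤ β) (hv : v₀ ≤ v) (hl : |l| ≤ l₁)
    (A : Matrix (Fin 2) (Fin 2) ℝ) :
    v₀ * bform β (symPart A) (symPart A) - (1 + 2 * β) * (l₁ / 2) * frobInner A A
      ≤ bform β (symPart A) (Gmat v l A) := by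
  have hS := mul_le_mul_of_nonneg_right hv (bform_symPart_self_nonneg hβ A)
  have hprod : |l * ((A 0 0 + A 1 1) * (A 0 1 - A 1 0))| ≤ l₁ * frobInner A A := by
    rw [abs_mul]
    exact mul_le_mul hl (abs_trace_mul_sub_le_frobInner A) (abs_nonneg _)
      ((abs_nonneg l).trans hl)
  have hlow := mul_le_mul_of_nonneg_left (neg_le_of_abs_le hprod)
    (by positivity : 0 ≤ (1 + 2 * β) / 2)
  rw [bform_symPart_Gmat]
  linarith

/-- Measure-theoretic form of the multiplier lemma (Lemma `Des_b` of the paper). -/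
theorem stmt_6 {Ω : Type*} [MeasurableSpace Ω] (μ : Measure Ω)
    (β lam₀ v₀ l₁ : ℝ) (hβ : 0 ≤ β) (hlam₀ : 0 < lam₀) (hl₁ : 0 ≤ l₁)
    (A : Ω → Matrix (Fin 2) (Fin 2) ℝ) (v l h : Ω → ℝ)
    (hAmeas : ∀ i j, Measurable fun x => A x i j) (hvmeas : Measurable v) (hlmeas : Measurable l)
    (hhmeas : Measurable h)
    (hh : ∀ x, 0 ≤ h x) (hv : ∀ x, v₀ ≤ v x) (hl : ∀ x, |l x| ≤ l₁)
    (hintA : Integrable (fun x => frobInner (A x) (A x)) μ)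
    (hintS : Integrable (fun x => bform β (symPart (A x)) (symPart (A x))) μ)
    (hintG : Integrable (fun x => bform β (symPart (A x)) (Gmat (v x) (l x) (A x))) μ)
    (hinth : Integrable h μ)
    (hKorn : ∫ x, frobInner (A x) (A x) ∂μ
      ≤ lam₀ * ∫ x, (bform β (symPart (A x)) (symPart (A x)) + h x) ∂μ) :
    (v₀ - lam₀ * (1 + 2 * β) * l₁ / 2) * ∫ x, bform β (symPart (A x)) (symPart (A x)) ∂μ
      - lam₀ * (1 + 2 * β) * (l₁ / 2) * ∫ x, h x ∂μ
      ≤ ∫ x, bform β (symPart (A x)) (Gmat (v x) (l x) (A x)) ∂μ := by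
  have hmono := integral_mono
    ((hintS.const_mul v₀).sub (hintA.const_mul ((1 + 2 * β) * (l₁ / 2)))) hintG
    fun x => le_bform_symPart_Gmat hβ (hv x) (hl x) (A x)
  simp only [Pi.sub_apply] at hmono
  rw [integral_sub (hintS.const_mul v₀) (hintA.const_mul _), integral_const_mul,
    integral_const_mul] at hmono
  rw [integral_add hintS hinth] at hKorn
  have hK := mul_le_mul_of_nonneg_left hKorn (by positivity : 0 ≤ (1 + 2 * β) * (l₁ / 2))
  linarith
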